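/- Let 0 < ρ, γ, k and set s = γ/k ∈ (0,1). For 1 ≤ x₁ ≤ x₂, we have |∫₁^{x₂} t^{ρ−1}[(x₂^ρ − t^ρ)^{s−1} − (x₁^ρ − t^ρ)^{s−1}]·g(t) dt| ≤ ‖g‖∞ · (k/(ργ)) · [2(x₂^ρ − x₁^ρ)^s + (x₁^ρ − 1)^s − (x₂^ρ − 1)^s + 2(x₂^ρ − x₁^ρ)^s] for any continuous bounded g; in particular the kernel difference integral is bounded by (k/(ργ))[2(x₂^ρ − x₁^ρ)^s + (x₂^ρ−1)^s − (x₁^ρ−1)^s] in absolute value after adding the boundary-segment integral. -/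

import Mathlib

open MeasureTheory in
/-- The left kernel is integrable, with the expected primitive. -/
theorem intervalIntegral_rpow_mul_const_sub_rpow {ρ s p q c : ℝ} (hρ : 0 < ρ) (hs : 0 < s)
    (hp : 0 < p) (hpq : p ≤ q) (hc : q ^ ρ ≤ c) :
    IntervalIntegrable (fun t : ℝ => t ^ (ρ - 1) * (c - t ^ ρ) ^ (s - 1)) volume p q ∧
      ∫ t in p..q, t ^ (ρ - 1) * (c - t ^ ρ) ^ (s - 1) =
        (ρ * s)⁻¹ * ((c - p ^ ρ) ^ s - (c - q ^ ρ) ^ s) := by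
  have hcont : ContinuousOn (fun t : ℝ => -(ρ * s)⁻¹ * (c - t ^ ρ) ^ s) (Set.Icc p q) :=
    (Continuous.mul continuous_const ((continuous_const.sub
      (Real.continuous_rpow_const hρ.le)).rpow_const fun _ => Or.inr hs.le)).continuousOn
  have hpos : ∀ t ∈ Set.Ioo p q, 0 < t ∧ 0 < c - t ^ ρ := fun t ht =>
    have ht0 := hp.trans ht.1
    ⟨ht0, sub_pos.2 ((Real.rpow_lt_rpow ht0.le ht.2 hρ).trans_le hc)⟩
  have hderiv : ∀ t ∈ Set.Ioo p q, HasDerivAt (fun t : ℝ => -(ρ * s)⁻¹ * (c - t ^ ρ) ^ s)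
      (t ^ (ρ - 1) * (c - t ^ ρ) ^ (s - 1)) t := fun t ht => by
    obtain ⟨ht0, hct⟩ := hpos t ht
    refine ((((Real.hasDerivAt_rpow_const (p := ρ) (Or.inl ht0.ne')).const_sub c).rpow_const
      (p := s) (Or.inl hct.ne')).const_mul (-(ρ * s)⁻¹)).congr_deriv ?_
    field_simp
  have hint : IntervalIntegrable (fun t : ℝ => t ^ (ρ - 1) * (c - t ^ ρ) ^ (s - 1))
      volume p q :=
    (intervalIntegrable_iff_integrableOn_Ioc_of_le hpq).2
      (intervalIntegral.integrableOn_deriv_of_nonneg hcont hderiv fun t ht =>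
        mul_nonneg (Real.rpow_nonneg (hpos t ht).1.le _) (Real.rpow_nonneg (hpos t ht).2.le _))
  refine ⟨hint, ?_⟩
  rw [intervalIntegral.integral_eq_sub_of_hasDerivAt_of_le hpq hcont hderiv hint]
  ring

open MeasureTheory in
/-- The right kernel is integrable, with the expected primitive. -/
theorem intervalIntegral_rpow_mul_rpow_sub_const {ρ s p q c : ℝ} (hρ : 0 < ρ) (hs : 0 < s)
    (hp : 0 < p) (hpq : p ≤ q) (hc : c ≤ p ^ ρ) :
    IntervalIntegrable (fun t : ℝ => t ^ (ρ - 1) * (t ^ ρ - c) ^ (s - 1)) volume p q ∧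
      ∫ t in p..q, t ^ (ρ - 1) * (t ^ ρ - c) ^ (s - 1) =
        (ρ * s)⁻¹ * ((q ^ ρ - c) ^ s - (p ^ ρ - c) ^ s) := by
  have hcont : ContinuousOn (fun t : ℝ => (ρ * s)⁻¹ * (t ^ ρ - c) ^ s) (Set.Icc p q) :=
    (Continuous.mul continuous_const (((Real.continuous_rpow_const hρ.le).sub
      continuous_const).rpow_const fun _ => Or.inr hs.le)).continuousOn
  have hpos : ∀ t ∈ Set.Ioo p q, 0 < t ∧ 0 < t ^ ρ - c := fun t ht =>
    ⟨hp.trans ht.1, sub_pos.2 (hc.trans_lt (Real.rpow_lt_rpow hp.le ht.1 hρ))⟩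
  have hderiv : ∀ t ∈ Set.Ioo p q, HasDerivAt (fun t : ℝ => (ρ * s)⁻¹ * (t ^ ρ - c) ^ s)
      (t ^ (ρ - 1) * (t ^ ρ - c) ^ (s - 1)) t := fun t ht => by
    obtain ⟨ht0, hct⟩ := hpos t ht
    refine ((((Real.hasDerivAt_rpow_const (p := ρ) (Or.inl ht0.ne')).sub_const c).rpow_const
      (p := s) (Or.inl hct.ne')).const_mul ((ρ * s)⁻¹)).congr_deriv ?_
    field_simp
  have hint : IntervalIntegrable (fun t : ℝ => t ^ (ρ - 1) * (t ^ ρ - c) ^ (s - 1))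
      volume p q :=
    (intervalIntegrable_iff_integrableOn_Ioc_of_le hpq).2
      (intervalIntegral.integrableOn_deriv_of_nonneg hcont hderiv fun t ht =>
        mul_nonneg (Real.rpow_nonneg (hpos t ht).1.le _) (Real.rpow_nonneg (hpos t ht).2.le _))
  refine ⟨hint, ?_⟩
  rw [intervalIntegral.integral_eq_sub_of_hasDerivAt_of_le hpq hcont hderiv hint]
  ring

theorem stmt6 (ρ γ k x₁ x₂ C : ℝ) (hρ : 0 < ρ) (hγ : 0 < γ) (hk : 0 < k)
    (s : ℝ) (hs : s = γ / k) (hs0 : 0 < s) (hs1 : s < 1)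
    (hx₁ : 1 ≤ x₁) (hx : x₁ ≤ x₂)
    (g : ℝ → ℝ) (hg : Continuous g) (hgC : ∀ t, |g t| ≤ C) :
    |∫ t in (1:ℝ)..x₂,
        t ^ (ρ - 1) * ((x₂ ^ ρ - t ^ ρ) ^ (s - 1) - (x₁ ^ ρ - t ^ ρ) ^ (s - 1)) * g t| ≤
      C * (k / (ρ * γ)) *
        (2 * (x₂ ^ ρ - x₁ ^ ρ) ^ s + (x₁ ^ ρ - 1) ^ s - (x₂ ^ ρ - 1) ^ s +
          2 * (x₂ ^ ρ - x₁ ^ ρ) ^ s) := by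
  have hC : 0 ≤ C := (abs_nonneg _).trans (hgC 0)
  have hx₁0 : 0 < x₁ := one_pos.trans_le hx₁
  have hab : x₁ ^ ρ ≤ x₂ ^ ρ := Real.rpow_le_rpow hx₁0.le hx hρ.le
  have hconst : k / (ρ * γ) = (ρ * s)⁻¹ := by rw [hs]; field_simp
  have hc0 : 0 ≤ (ρ * s)⁻¹ := by positivity
  rw [hconst]
  set f : ℝ → ℝ := fun t =>
    t ^ (ρ - 1) * ((x₂ ^ ρ - t ^ ρ) ^ (s - 1) - (x₁ ^ ρ - t ^ ρ) ^ (s - 1)) * g t with hf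
  have hleft : |∫ t in (1:ℝ)..x₁, f t| ≤ C * ((ρ * s)⁻¹ *
      ((x₁ ^ ρ - 1) ^ s - (x₂ ^ ρ - 1) ^ s + (x₂ ^ ρ - x₁ ^ ρ) ^ s)) := by
    obtain ⟨hi₁, he₁⟩ := intervalIntegral_rpow_mul_const_sub_rpow hρ hs0 one_pos hx₁ le_rfl
    obtain ⟨hi₂, he₂⟩ := intervalIntegral_rpow_mul_const_sub_rpow hρ hs0 one_pos hx₁ hab
    have hne : ∀ᵐ t : ℝ, t ≠ x₁ := by simp [MeasureTheory.ae_iff]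
    have h := intervalIntegral.norm_integral_le_of_norm_le (f := f) hx₁
      (by
        filter_upwards [hne] with t htne ht
        have ht0 : 0 < t := one_pos.trans ht.1
        have hta : 0 < x₁ ^ ρ - t ^ ρ :=
          sub_pos.2 (Real.rpow_lt_rpow ht0.le (lt_of_le_of_ne ht.2 htne) hρ)
        have hle : (x₂ ^ ρ - t ^ ρ) ^ (s - 1) ≤ (x₁ ^ ρ - t ^ ρ) ^ (s - 1) :=
          Real.rpow_le_rpow_of_nonpos hta (by linarith) (by linarith)
        have h0 : 0 ≤ t ^ (ρ - 1) := Real.rpow_nonneg ht0.le _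
        rw [hf, Real.norm_eq_abs, abs_mul, abs_mul, abs_of_nonneg h0,
          abs_of_nonpos (sub_nonpos.2 hle), neg_sub, mul_comm, mul_sub]
        exact mul_le_mul_of_nonneg_right (hgC t)
          (by rw [← mul_sub]; exact mul_nonneg h0 (sub_nonneg.2 hle)))
      ((hi₁.sub hi₂).const_mul C)
    rw [intervalIntegral.integral_const_mul, intervalIntegral.integral_sub hi₁ hi₂, he₁, he₂,
      Real.one_rpow, sub_self, Real.zero_rpow hs0.ne', Real.norm_eq_abs] at h
    exact h.trans_eq (by ring)
  have hright : |∫ t in x₁..x₂, f t| ≤ C * ((ρ * s)⁻¹ * (2 * (x₂ ^ ρ - x₁ ^ ρ) ^ s)) := by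
    obtain ⟨hi₁, he₁⟩ := intervalIntegral_rpow_mul_const_sub_rpow hρ hs0 hx₁0 hx le_rfl
    obtain ⟨hi₂, he₂⟩ := intervalIntegral_rpow_mul_rpow_sub_const hρ hs0 hx₁0 hx le_rfl
    have h := intervalIntegral.norm_integral_le_of_norm_le (f := f) hx
      (by
        refine Filter.Eventually.of_forall fun t ht => ?_
        have ht0 : 0 < t := hx₁0.trans ht.1
        have hat : 0 ≤ t ^ ρ - x₁ ^ ρ := sub_nonneg.2 (Real.rpow_le_rpow hx₁0.le ht.1.le hρ.le)
        have htb : 0 ≤ x₂ ^ ρ - t ^ ρ := sub_nonneg.2 (Real.rpow_le_rpow ht0.le ht.2 hρ.le)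
        have h0 : 0 ≤ t ^ (ρ - 1) := Real.rpow_nonneg ht0.le _
        have hle : |(x₂ ^ ρ - t ^ ρ) ^ (s - 1) - (x₁ ^ ρ - t ^ ρ) ^ (s - 1)| ≤
            (x₂ ^ ρ - t ^ ρ) ^ (s - 1) + (t ^ ρ - x₁ ^ ρ) ^ (s - 1) := by
          have h₁ := Real.abs_rpow_le_abs_rpow (x₁ ^ ρ - t ^ ρ) (s - 1)
          rw [abs_sub_comm, abs_of_nonneg hat] at h₁
          exact (abs_sub _ _).trans
            (add_le_add (abs_of_nonneg (Real.rpow_nonneg htb _)).le h₁)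
        rw [hf, Real.norm_eq_abs, abs_mul, abs_mul, abs_of_nonneg h0, mul_comm]
        refine (mul_le_mul (hgC t) (mul_le_mul_of_nonneg_left hle h0)
          (by positivity) hC).trans_eq ?_
        rw [mul_add])
      ((hi₁.add hi₂).const_mul C)
    rw [intervalIntegral.integral_const_mul, intervalIntegral.integral_add hi₁ hi₂, he₁, he₂,
      sub_self, sub_self, Real.zero_rpow hs0.ne', Real.norm_eq_abs] at h
    exact h.trans_eq (by ring)
  have hsum : |∫ t in (1:ℝ)..x₂, f t| ≤
      |∫ t in (1:ℝ)..x₁, f t| + |∫ t in x₁..x₂, f t| := by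
    by_cases hi : IntervalIntegrable f MeasureTheory.volume 1 x₂
    · have hm : x₁ ∈ Set.uIcc 1 x₂ := Set.mem_uIcc_of_le hx₁ hx
      rw [← intervalIntegral.integral_add_adjacent_intervals
        (hi.mono_set (Set.uIcc_subset_uIcc_left hm)) (hi.mono_set (Set.uIcc_subset_uIcc_right hm))]
      exact abs_add_le _ _
    · rw [intervalIntegral.integral_undef hi, abs_zero]
      positivity
  have hextra : 0 ≤ C * (ρ * s)⁻¹ * (x₂ ^ ρ - x₁ ^ ρ) ^ s :=
    mul_nonneg (mul_nonneg hC hc0) (Real.rpow_nonneg (sub_nonneg.2 hab) _)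
  linarith
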